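/- Let 0 < p < λ and X̄ > 0, and let F : [0, X̄] → ℝ be continuous and strictly increasing with F(0) = 0 and F(X̄) = 1. Let q ∈ (0, X̄) satisfy F(q) = p/λ. Then p·q − λ·∫₀^q F(t) dt < p·(X̄ − ∫₀^{X̄} F(t) dt). -/

import Mathlib

/-- Theorem 3 (general distribution part): for a CDF F continuous and strictly increasing
on [0, X̄] with F(0) = 0, F(X̄) = 1, and q ∈ (0, X̄) with F(q) = p/λ (0 < p < λ),
the without-storage revenue p·q − λ·∫₀^q F is strictly below the with-storage revenue
p·E[X] = p·(X̄ − ∫₀^{X̄} F). -/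
theorem with_storage_revenue_dominates
    (p lam Xbar q : ℝ) (F : ℝ → ℝ)
    (hp : 0 < p) (hplam : p < lam) (hXbar : 0 < Xbar)
    (hFcont : ContinuousOn F (Set.Icc 0 Xbar))
    (hFmono : StrictMonoOn F (Set.Icc 0 Xbar))
    (hF0 : F 0 = 0) (hF1 : F Xbar = 1)
    (hq : q ∈ Set.Ioo 0 Xbar) (hFq : F q = p / lam) :
    p * q - lam * ∫ t in (0:ℝ)..q, F t <
      p * (Xbar - ∫ t in (0:ℝ)..Xbar, F t) := by
  obtain ⟨hq0, hqX⟩ := hq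
  have hi1 : IntervalIntegrable F MeasureTheory.volume 0 q := by
    apply ContinuousOn.intervalIntegrable
    rw [Set.uIcc_of_le hq0.le]
    exact hFcont.mono (Set.Icc_subset_Icc_right hqX.le)
  have hi2 : IntervalIntegrable F MeasureTheory.volume q Xbar := by
    apply ContinuousOn.intervalIntegrable
    rw [Set.uIcc_of_le hqX.le]
    exact hFcont.mono (Set.Icc_subset_Icc_left hq0.le)
  have hA : 0 < ∫ t in (0:ℝ)..q, F t := by
    apply intervalIntegral.intervalIntegral_pos_of_pos_on hi1 _ hq0
    intro x hx
    rw [← hF0]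
    exact hFmono ⟨le_rfl, hXbar.le⟩ ⟨hx.1.le, (hx.2.trans hqX).le⟩ hx.1
  have hB : ∫ t in q..Xbar, F t ≤ Xbar - q := by
    have h := intervalIntegral.integral_mono_on (g := fun _ => (1:ℝ)) hqX.le hi2
      intervalIntegrable_const (fun x hx => by
        rw [← hF1]
        exact hFmono.monotoneOn ⟨hq0.le.trans hx.1, hx.2⟩ ⟨hXbar.le, le_rfl⟩ hx.2)
    simpa using h
  rw [← intervalIntegral.integral_add_adjacent_intervals hi1 hi2]
  have h1 := mul_pos (sub_pos.2 hplam) hA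
  have h2 := mul_le_mul_of_nonneg_left hB hp.le
  linarith
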